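/- Let m ≥ 1 and ξ ≥ 0, and for each j ∈ {1,…,m} let D_j and D̂_j be probability measures on ℝ with Kolmogorov distance ||D_j − D̂_j||_K ≤ ξ. Let u : ℝ^m → ℝ be Borel measurable and nondecreasing in each coordinate (i.e., u(s) ≤ u(t) whenever s_j ≤ t_j for every j), and let δ ∈ ℝ. Then |Pr_{t ∼ ∏_{j=1}^m D_j}[u(t) ≥ δ] − Pr_{t ∼ ∏_{j=1}^m D̂_j}[u(t) ≥ δ]| ≤ 2mξ. -/

import Mathlib

open MeasureTheory

lemma aux_Iio (μ ν : Measure ℝ) [IsProbabilityMeasure μ] [IsProbabilityMeasure ν] (ξ : ℝ)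
    (h : ∀ x, |(μ (Set.Iic x)).toReal - (ν (Set.Iic x)).toReal| ≤ ξ) (a : ℝ) :
    |(μ (Set.Iio a)).toReal - (ν (Set.Iio a)).toReal| ≤ ξ := by
  obtain ⟨w, hw, hlt, hlim⟩ := exists_seq_strictMono_tendsto a
  have hU : (⋃ n, Set.Iic (w n)) = Set.Iio a := by
    ext x
    simp only [Set.mem_iUnion, Set.mem_Iic, Set.mem_Iio]
    constructor
    · rintro ⟨n, hn⟩
      exact lt_of_le_of_lt hn (hlt n)
    · intro hx
      obtain ⟨n, hn⟩ := (hlim.eventually (lt_mem_nhds hx)).exists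
      exact ⟨n, hn.le⟩
  have hm : Monotone (fun n => Set.Iic (w n)) := fun i j hij =>
    Set.Iic_subset_Iic.2 (hw.monotone hij)
  have key : ∀ (ρ : Measure ℝ) [IsProbabilityMeasure ρ],
      Filter.Tendsto (fun n => (ρ (Set.Iic (w n))).toReal) Filter.atTop
        (nhds (ρ (Set.Iio a)).toReal) := by
    intro ρ _
    have := tendsto_measure_iUnion_atTop (μ := ρ) hm
    rw [hU] at this
    exact (ENNReal.tendsto_toReal (measure_ne_top ρ _)).comp this
  exact le_of_tendsto ((key μ).sub (key ν)).abs (Filter.Eventually.of_forall fun n => h (w n))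

lemma aux_compl (μ ν : Measure ℝ) [IsProbabilityMeasure μ] [IsProbabilityMeasure ν] (ξ : ℝ)
    (S : Set ℝ) (hS : MeasurableSet S)
    (h : |(μ S).toReal - (ν S).toReal| ≤ ξ) :
    |(μ Sᶜ).toReal - (ν Sᶜ).toReal| ≤ ξ := by
  have h1 := probReal_compl_eq_one_sub (μ := μ) hS
  have h2 := probReal_compl_eq_one_sub (μ := ν) hS
  simp only [Measure.real] at h1 h2
  rw [h1, h2, abs_sub_comm]
  convert h using 2
  ring

lemma aux_upper (μ ν : Measure ℝ) [IsProbabilityMeasure μ] [IsProbabilityMeasure ν] (ξ : ℝ)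
    (hξ : 0 ≤ ξ)
    (h : ∀ x, |(μ (Set.Iic x)).toReal - (ν (Set.Iic x)).toReal| ≤ ξ) (S : Set ℝ)
    (hS : IsUpperSet S) :
    |(μ S).toReal - (ν S).toReal| ≤ ξ := by
  rcases S.eq_empty_or_nonempty with rfl | hne
  · simpa using hξ
  by_cases hb : BddBelow S
  · by_cases hmem : sInf S ∈ S
    · have : S = (Set.Iio (sInf S))ᶜ := by
        ext x
        simp only [Set.mem_compl_iff, Set.mem_Iio, not_lt]
        exact ⟨fun hx => csInf_le hb hx, fun hx => hS hx hmem⟩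
      rw [this]
      exact aux_compl μ ν ξ _ measurableSet_Iio (aux_Iio μ ν ξ h _)
    · have : S = (Set.Iic (sInf S))ᶜ := by
        ext x
        simp only [Set.mem_compl_iff, Set.mem_Iic, not_le]
        constructor
        · intro hx
          exact lt_of_le_of_ne (csInf_le hb hx) (fun e => hmem (e ▸ hx))
        · intro hx
          obtain ⟨y, hy, hyx⟩ := exists_lt_of_csInf_lt hne hx
          exact hS hyx.le hy
      rw [this]
      exact aux_compl μ ν ξ _ measurableSet_Iic (h _)
  · have : S = Set.univ := by
      ext x
      simp only [Set.mem_univ, iff_true]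
      rw [not_bddBelow_iff] at hb
      obtain ⟨y, hy, hyx⟩ := hb x
      exact hS hyx.le hy
    rw [this]
    simpa using hξ

lemma aux_int {α : Type*} [MeasurableSpace α] (μ : Measure α) [IsProbabilityMeasure μ]
    (f g : α → ENNReal) (hf : Measurable f) (hg : Measurable g)
    (hf1 : ∀ x, f x ≤ 1) (hg1 : ∀ x, g x ≤ 1) (c : ℝ)
    (h : ∀ x, |(f x).toReal - (g x).toReal| ≤ c) :
    |(∫⁻ x, f x ∂μ).toReal - (∫⁻ x, g x ∂μ).toReal| ≤ c := by
  have hi : ∀ k : α → ENNReal, Measurable k → (∀ x, k x ≤ 1) →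
      Integrable (fun x => (k x).toReal) μ := by
    intro k hk hk1
    refine Integrable.of_bound hk.ennreal_toReal.aestronglyMeasurable 1
      (Filter.Eventually.of_forall fun x => ?_)
    rw [Real.norm_of_nonneg ENNReal.toReal_nonneg]
    exact ENNReal.toReal_le_of_le_ofReal zero_le_one (by simpa using hk1 x)
  rw [← integral_toReal hf.aemeasurable
      (Filter.Eventually.of_forall fun x => (hf1 x).trans_lt ENNReal.one_lt_top),
    ← integral_toReal hg.aemeasurable
      (Filter.Eventually.of_forall fun x => (hg1 x).trans_lt ENNReal.one_lt_top),
    ← integral_sub (hi f hf hf1) (hi g hg hg1)]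
  have := norm_integral_le_of_norm_le_const (μ := μ)
    (f := fun x => (f x).toReal - (g x).toReal) (C := c) (Filter.Eventually.of_forall h)
  simpa using this

lemma aux_main (ξ : ℝ) (hξ : 0 ≤ ξ) : ∀ (m : ℕ) (D E : Fin m → Measure ℝ)
    [∀ j, IsProbabilityMeasure (D j)] [∀ j, IsProbabilityMeasure (E j)]
    (_ : ∀ (j : Fin m) (x : ℝ),
      |((D j) (Set.Iic x)).toReal - ((E j) (Set.Iic x)).toReal| ≤ ξ)
    (A : Set (Fin m → ℝ)) (_ : MeasurableSet A) (_ : IsUpperSet A),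
    |((Measure.pi D) A).toReal - ((Measure.pi E) A).toReal| ≤ m * ξ := by
  intro m
  induction m with
  | zero =>
    intro D E _ _ _ A _ _
    rw [Subsingleton.elim D E]
    simp
  | succ n ih =>
    intro D E _ _ hK A hA hup
    let e := MeasurableEquiv.piFinSuccAbove (fun _ : Fin (n + 1) => ℝ) 0
    let B : Set (ℝ × (Fin n → ℝ)) := e.symm ⁻¹' A
    have hB : MeasurableSet B := e.symm.measurable hA
    have hBup : ∀ p q : ℝ × (Fin n → ℝ), p ≤ q → p ∈ B → q ∈ B := by
      intro p q hpq hp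
      refine hup ?_ hp
      intro j
      refine Fin.cases ?_ (fun i => ?_) j
      · exact hpq.1
      · exact hpq.2 i
    have red : ∀ (F : Fin (n + 1) → Measure ℝ) [∀ j, IsProbabilityMeasure (F j)],
        Measure.pi F A = ((F 0).prod (Measure.pi fun j : Fin n => F j.succ)) B := by
      intro F _
      have := (measurePreserving_piFinSuccAbove F 0).symm.measure_preimage hA.nullMeasurableSet
      exact this.symm
    rw [red D, red E]
    set P := Measure.pi fun j : Fin n => D j.succ
    set Q := Measure.pi fun j : Fin n => E j.succ
    have h1 : |(((D 0).prod P) B).toReal - (((D 0).prod Q) B).toReal| ≤ n * ξ := by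
      rw [Measure.prod_apply hB, Measure.prod_apply hB]
      refine aux_int _ _ _ (measurable_measure_prodMk_left hB) (measurable_measure_prodMk_left hB)
        (fun x => prob_le_one) (fun x => prob_le_one) _ (fun x => ?_)
      refine ih _ _ (fun j => hK j.succ) _ (measurable_prodMk_left hB) ?_
      intro s t hst hs
      exact hBup (x, s) (x, t) ⟨le_rfl, hst⟩ hs
    have h2 : |(((D 0).prod Q) B).toReal - (((E 0).prod Q) B).toReal| ≤ ξ := by
      rw [Measure.prod_apply_symm hB, Measure.prod_apply_symm hB]
      refine aux_int _ _ _ (measurable_measure_prodMk_right hB)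
        (measurable_measure_prodMk_right hB)
        (fun x => prob_le_one) (fun x => prob_le_one) _ (fun y => ?_)
      refine aux_upper _ _ ξ hξ (hK 0) _ ?_
      intro s t hst hs
      exact hBup (s, y) (t, y) ⟨hst, le_rfl⟩ hs
    have h3 := abs_sub_le (((D 0).prod P) B).toReal (((D 0).prod Q) B).toReal
      (((E 0).prod Q) B).toReal
    push_cast
    linarith


/-- If the item marginals `D j` and `Dhat j` are within `ξ` in Kolmogorov
distance, then for any Borel measurable function `u : ℝ^m → ℝ` that is nondecreasing in each
coordinate and any threshold `δ`, the probabilities of the superlevel event `{t : u t ≥ δ}`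
under the two product measures differ by at most `2mξ`. -/
theorem monotone_superlevel_stability
    {m : ℕ} (hm : 1 ≤ m) (ξ : ℝ) (hξ : 0 ≤ ξ)
    (D Dhat : Fin m → Measure ℝ)
    [∀ j, IsProbabilityMeasure (D j)] [∀ j, IsProbabilityMeasure (Dhat j)]
    (hK : ∀ (j : Fin m) (x : ℝ),
      |((D j) (Set.Iic x)).toReal - ((Dhat j) (Set.Iic x)).toReal| ≤ ξ)
    (u : (Fin m → ℝ) → ℝ) (hu : Measurable u)
    (hmono : ∀ s t : Fin m → ℝ, (∀ j, s j ≤ t j) → u s ≤ u t)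
    (δ : ℝ) :
    |((Measure.pi D) {t | δ ≤ u t}).toReal - ((Measure.pi Dhat) {t | δ ≤ u t}).toReal| ≤
      2 * m * ξ := by

  have h := aux_main ξ hξ m D Dhat hK {t | δ ≤ u t} (measurableSet_le measurable_const hu)
    (fun s t hst hs => le_trans hs (hmono s t hst))
  have h0 : 0 ≤ (m : ℝ) * ξ := by positivity
  linarith
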